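/- For every A ∈ B(H), w(A)⁴ ≥ (1/16)‖(A*A + AA*)² + 4(Re(A²))²‖ + (1/2)|‖Re(A)‖⁴ − ‖Im(A)‖⁴|, and moreover (1/16)‖(A*A + AA*)² + 4(Re(A²))²‖ ≥ (1/16)‖A*A + AA*‖² + (1/4)c((Re(A²))²). -/

import Mathlib

open ContinuousLinearMap Filter
open scoped ComplexInnerProductSpace Topology

variable {H : Type*} [NormedAddCommGroup H] [InnerProductSpace ℂ H]
  [CompleteSpace H] [Nontrivial H]

/-- The numerical range of a bounded linear operator. -/
noncomputable def numRange (A : H →L[ℂ] H) : Set ℂ :=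
  {z : ℂ | ∃ x : H, ‖x‖ = 1 ∧ z = ⟪x, A x⟫}

/-- The numerical radius of a bounded linear operator. -/
noncomputable def numRadius (A : H →L[ℂ] H) : ℝ :=
  sSup {r : ℝ | ∃ x : H, ‖x‖ = 1 ∧ r = ‖(⟪x, A x⟫)‖}

/-- The Crawford number of a bounded linear operator. -/
noncomputable def crawford (A : H →L[ℂ] H) : ℝ :=
  sInf {r : ℝ | ∃ x : H, ‖x‖ = 1 ∧ r = ‖(⟪x, A x⟫)‖}

/-- The real part `(A + A*)/2` of a bounded linear operator. -/
noncomputable def reOp (A : H →L[ℂ] H) : H →L[ℂ] H :=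
  (2 : ℂ)⁻¹ • (A + ContinuousLinearMap.adjoint A)

/-- The imaginary part `(A - A*)/(2i)` of a bounded linear operator. -/
noncomputable def imOp (A : H →L[ℂ] H) : H →L[ℂ] H :=
  (2 * Complex.I)⁻¹ • (A - ContinuousLinearMap.adjoint A)

theorem norm_le_of_abs_re_inner_le {E : Type*} [NormedAddCommGroup E] [InnerProductSpace ℂ E]
    [CompleteSpace E] {T : E →L[ℂ] E} (hT : IsSelfAdjoint T) {C : ℝ} (hC : 0 ≤ C)
    (h : ∀ x : E, ‖x‖ = 1 → |(⟪x, T x⟫).re| ≤ C) : ‖T‖ ≤ C := by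
  rw [T.norm_eq_iSup_rayleighQuotient hT.isSymmetric]
  refine ciSup_le fun x => ?_
  by_cases hx : x = 0
  · simpa [hx] using hC
  have hnorm : ‖(‖x‖⁻¹ : ℂ) • x‖ = 1 := by
    simp [norm_smul, hx]
  have hc : (‖x‖⁻¹ : ℂ) ≠ 0 := by simp [hx]
  rw [← T.rayleigh_smul x hc, rayleighQuotient, hnorm, reApplyInnerSelf_apply, inner_re_symm]
  rw [one_pow, div_one]
  exact h _ hnorm

theorem norm_inner_apply_self_le_norm {E : Type*} [NormedAddCommGroup E] [InnerProductSpace ℂ E]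
    (T : E →L[ℂ] E) {x : E} (hx : ‖x‖ = 1) : ‖⟪x, T x⟫‖ ≤ ‖T‖ := by
  simpa [hx] using (norm_inner_le_norm (𝕜 := ℂ) x (T x)).trans
    (mul_le_mul_of_nonneg_left (T.le_opNorm x) (norm_nonneg x))

theorem norm_inner_le_numRadius {E : Type*} [NormedAddCommGroup E] [InnerProductSpace ℂ E]
    (A : E →L[ℂ] E) {x : E} (hx : ‖x‖ = 1) : ‖⟪x, A x⟫‖ ≤ numRadius A := by
  refine le_csSup ⟨‖A‖, ?_⟩ ⟨x, hx, rfl⟩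
  rintro _ ⟨y, hy, rfl⟩
  exact norm_inner_apply_self_le_norm A hy

theorem numRadius_nonneg {E : Type*} [NormedAddCommGroup E] [InnerProductSpace ℂ E]
    (A : E →L[ℂ] E) : 0 ≤ numRadius A := by
  refine Real.sSup_nonneg ?_
  rintro _ ⟨x, -, rfl⟩
  exact norm_nonneg _

theorem crawford_le_norm_inner {E : Type*} [NormedAddCommGroup E] [InnerProductSpace ℂ E]
    (A : E →L[ℂ] E) {x : E} (hx : ‖x‖ = 1) : crawford A ≤ ‖⟪x, A x⟫‖ := by
  refine csInf_le ⟨0, ?_⟩ ⟨x, hx, rfl⟩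
  rintro _ ⟨y, -, rfl⟩
  exact norm_nonneg _

section CartesianDecomposition

variable {E : Type*} [NormedAddCommGroup E] [InnerProductSpace ℂ E] [CompleteSpace E]

theorem isSelfAdjoint_reOp (A : E →L[ℂ] E) : IsSelfAdjoint (reOp A) := by
  simp [isSelfAdjoint_iff, reOp, star_eq_adjoint, add_comm]

theorem isSelfAdjoint_imOp (A : E →L[ℂ] E) : IsSelfAdjoint (imOp A) := by
  simp only [isSelfAdjoint_iff, imOp, star_eq_adjoint, map_sub, map_smulₛₗ, adjoint_adjoint]
  rw [← neg_sub A, smul_neg, ← neg_smul]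
  simp [Complex.conj_ofNat]

theorem inner_reOp_self (A : E →L[ℂ] E) (x : E) : ⟪x, reOp A x⟫ = (⟪x, A x⟫).re := by
  simp only [reOp, smul_apply, add_apply, inner_smul_right, inner_add_right,
    adjoint_inner_right]
  rw [← inner_conj_symm (A x) x, Complex.add_conj]
  push_cast
  ring

theorem inner_imOp_self (A : E →L[ℂ] E) (x : E) : ⟪x, imOp A x⟫ = (⟪x, A x⟫).im := by
  simp only [imOp, smul_apply, sub_apply, inner_smul_right, inner_sub_right,
    adjoint_inner_right]
  rw [← inner_conj_symm (A x) x, Complex.sub_conj]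
  push_cast
  field_simp

theorem norm_reOp_le_numRadius (A : E →L[ℂ] E) : ‖reOp A‖ ≤ numRadius A := by
  refine norm_le_of_abs_re_inner_le (isSelfAdjoint_reOp A) (numRadius_nonneg A) fun x hx => ?_
  rw [inner_reOp_self, Complex.ofReal_re]
  exact (Complex.abs_re_le_norm _).trans (norm_inner_le_numRadius A hx)

theorem norm_imOp_le_numRadius (A : E →L[ℂ] E) : ‖imOp A‖ ≤ numRadius A := by
  refine norm_le_of_abs_re_inner_le (isSelfAdjoint_imOp A) (numRadius_nonneg A) fun x hx => ?_
  rw [inner_imOp_self, Complex.ofReal_re]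
  exact (Complex.abs_im_le_norm _).trans (norm_inner_le_numRadius A hx)

theorem reOp_sq (A : E →L[ℂ] E) :
    reOp A ^ 2 = (4 : ℂ)⁻¹ • ((A + adjoint A) * (A + adjoint A)) := by
  rw [reOp, sq, smul_mul_smul_comm]
  norm_num

theorem imOp_sq (A : E →L[ℂ] E) :
    imOp A ^ 2 = (-(4 : ℂ)⁻¹) • ((A - adjoint A) * (A - adjoint A)) := by
  rw [imOp, sq, smul_mul_smul_comm, ← mul_inv, mul_mul_mul_comm, Complex.I_mul_I]
  norm_num

theorem adjoint_comp_self_add_self_comp_adjoint (A : E →L[ℂ] E) :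
    adjoint A ∘L A + A ∘L adjoint A = (2 : ℂ) • (reOp A ^ 2 + imOp A ^ 2) := by
  simp only [reOp_sq, imOp_sq, ← mul_def, mul_add, add_mul, mul_sub, sub_mul]
  module

theorem reOp_comp_self (A : E →L[ℂ] E) : reOp (A ∘L A) = reOp A ^ 2 - imOp A ^ 2 := by
  rw [reOp_sq, imOp_sq, reOp, adjoint_comp]
  simp only [← mul_def, mul_add, add_mul, mul_sub, sub_mul]
  module

theorem sq_add_four_smul_reOp_sq (A : E →L[ℂ] E) :
    (adjoint A ∘L A + A ∘L adjoint A) ^ 2 + (4 : ℂ) • reOp (A ∘L A) ^ 2 =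
      (8 : ℂ) • (reOp A ^ 4 + imOp A ^ 4) := by
  rw [adjoint_comp_self_add_self_comp_adjoint, reOp_comp_self,
    show reOp A ^ 4 = reOp A ^ 2 * reOp A ^ 2 from pow_add _ 2 2,
    show imOp A ^ 4 = imOp A ^ 2 * imOp A ^ 2 from pow_add _ 2 2]
  generalize reOp A ^ 2 = P, imOp A ^ 2 = Q
  rw [sq, sq, smul_mul_smul_comm]
  simp only [mul_add, add_mul, mul_sub, sub_mul]
  module

end CartesianDecomposition

theorem IsSelfAdjoint.inner_sq_apply_self {E : Type*} [NormedAddCommGroup E]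
    [InnerProductSpace ℂ E] [CompleteSpace E] {T : E →L[ℂ] E} (hT : IsSelfAdjoint T) (x : E) :
    ⟪x, (T ^ 2) x⟫ = (‖T x‖ : ℂ) ^ 2 := by
  rw [sq, mul_apply_eq_comp, ← hT.isSymmetric.apply_clm]
  exact inner_self_eq_norm_sq_to_K (𝕜 := ℂ) (T x)

theorem norm_sq_add_four_mul_crawford_le {E : Type*} [NormedAddCommGroup E]
    [InnerProductSpace ℂ E] [CompleteSpace E] [Nontrivial E] {S R : E →L[ℂ] E}
    (hS : IsSelfAdjoint S) (hR : IsSelfAdjoint R) :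
    ‖S‖ ^ 2 + 4 * crawford (R ^ 2) ≤ ‖S ^ 2 + (4 : ℂ) • R ^ 2‖ := by
  set N := ‖S ^ 2 + (4 : ℂ) • R ^ 2‖
  have key (x : E) (hx : ‖x‖ = 1) : ‖S x‖ ^ 2 ≤ N - 4 * crawford (R ^ 2) := by
    have hc := crawford_le_norm_inner (R ^ 2) hx
    have hN := norm_inner_apply_self_le_norm (S ^ 2 + (4 : ℂ) • R ^ 2) hx
    have hsum : ⟪x, (S ^ 2 + (4 : ℂ) • R ^ 2) x⟫ = ((‖S x‖ ^ 2 + 4 * ‖R x‖ ^ 2 : ℝ) : ℂ) := by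
      rw [add_apply, smul_apply, inner_add_right, inner_smul_right, hS.inner_sq_apply_self,
        hR.inner_sq_apply_self]
      push_cast
      rfl
    rw [hsum, Complex.norm_of_nonneg (by positivity)] at hN
    rw [hR.inner_sq_apply_self, norm_pow, Complex.norm_real, norm_norm] at hc
    linarith
  obtain ⟨x, hx⟩ := exists_norm_eq E zero_le_one
  have h0 := (sq_nonneg _).trans (key x hx)
  have hle : ‖S‖ ≤ √(N - 4 * crawford (R ^ 2)) :=
    opNorm_le_of_unit_norm (Real.sqrt_nonneg _) fun y hy => Real.le_sqrt_of_sq_le (key y hy)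
  have := (Real.le_sqrt (norm_nonneg _) h0).1 hle
  linarith

/-- For every `A ∈ B(H)`,
`w(A)⁴ ≥ (1/16)‖(A*A + AA*)² + 4(Re(A²))²‖ + (1/2)|‖Re A‖⁴ − ‖Im A‖⁴|`, and moreover
`(1/16)‖(A*A + AA*)² + 4(Re(A²))²‖ ≥ (1/16)‖A*A + AA*‖² + (1/4)c((Re(A²))²)`. -/
theorem stmt17 (A : H →L[ℂ] H) :
    numRadius A ^ 4 ≥
      (1 / 16) * ‖(adjoint A ∘L A + A ∘L adjoint A) ^ 2 + (4 : ℂ) • reOp (A ∘L A) ^ 2‖ +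
        (1 / 2) * |‖reOp A‖ ^ 4 - ‖imOp A‖ ^ 4| ∧
    (1 / 16) * ‖(adjoint A ∘L A + A ∘L adjoint A) ^ 2 + (4 : ℂ) • reOp (A ∘L A) ^ 2‖ ≥
      (1 / 16) * ‖adjoint A ∘L A + A ∘L adjoint A‖ ^ 2 +
        (1 / 4) * crawford (reOp (A ∘L A) ^ 2) := by
  constructor
  · have hP : ‖reOp A‖ ^ 4 ≤ numRadius A ^ 4 := by gcongr; exact norm_reOp_le_numRadius A
    have hQ : ‖imOp A‖ ^ 4 ≤ numRadius A ^ 4 := by gcongr; exact norm_imOp_le_numRadius A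
    have hsum : ‖reOp A ^ 4 + imOp A ^ 4‖ ≤ ‖reOp A‖ ^ 4 + ‖imOp A‖ ^ 4 :=
      (norm_add_le _ _).trans (add_le_add (norm_pow_le _ _) (norm_pow_le _ _))
    rw [sq_add_four_smul_reOp_sq, norm_smul, Complex.norm_ofNat]
    rcases abs_cases (‖reOp A‖ ^ 4 - ‖imOp A‖ ^ 4) with ⟨h, -⟩ | ⟨h, -⟩ <;> rw [h] <;> linarith
  · have hS : IsSelfAdjoint (adjoint A ∘L A + A ∘L adjoint A) :=
      (IsSelfAdjoint.star_mul_self A).add (IsSelfAdjoint.mul_star_self A)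
    have := norm_sq_add_four_mul_crawford_le hS (isSelfAdjoint_reOp (A ∘L A))
    linarith
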